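/- The function Z ↦ G^F(Z) − log ‖Z‖ is bounded on ℂ² ∖ {(0,0)} and is invariant under scaling: for every c ∈ ℂ ∖ {0} and every Z ∈ ℂ² ∖ {(0,0)}, G^F(cZ) − log ‖cZ‖ = G^F(Z) − log ‖Z‖ (so it descends to a bounded continuous function, the dynamical Green function, on ℙ¹(ℂ)). -/

import Mathlib

open Filter Finset MvPolynomial

/-- Evaluation of a bivariate polynomial at a point of `ℂ²`. -/
noncomputable def ev (P : MvPolynomial (Fin 2) ℂ) (Z : ℂ × ℂ) : ℂ :=
  MvPolynomial.eval ![Z.1, Z.2] P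

/-- The self-map of `ℂ²` determined by the pair `F = (F₀, F₁)`. -/
noncomputable def Fmap (F₀ F₁ : MvPolynomial (Fin 2) ℂ) (Z : ℂ × ℂ) : ℂ × ℂ :=
  (ev F₀ Z, ev F₁ Z)

/-- The Euclidean norm on `ℂ²`. -/
noncomputable def enorm2 (Z : ℂ × ℂ) : ℝ := Real.sqrt (‖Z.1‖ ^ 2 + ‖Z.2‖ ^ 2)

theorem aux_enorm2_pos {Z : ℂ × ℂ} (h : Z ≠ 0) : 0 < enorm2 Z := by
  unfold enorm2
  apply Real.sqrt_pos.mpr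
  by_cases h1 : Z.1 = 0
  · have h2 : Z.2 ≠ 0 := fun h2 => h (Prod.ext h1 h2)
    have := norm_pos_iff.mpr h2
    positivity
  · have := norm_pos_iff.mpr h1
    positivity

theorem aux_enorm2_smul (c : ℂ) (Z : ℂ × ℂ) : enorm2 (c • Z) = ‖c‖ * enorm2 Z := by
  unfold enorm2
  simp only [Prod.smul_fst, Prod.smul_snd, norm_smul]
  rw [show (‖c‖ * ‖Z.1‖) ^ 2 + (‖c‖ * ‖Z.2‖) ^ 2 = ‖c‖ ^ 2 * (‖Z.1‖ ^ 2 + ‖Z.2‖ ^ 2) by ring,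
    Real.sqrt_mul (by positivity), Real.sqrt_sq (norm_nonneg c)]

theorem aux_ev_smul {d : ℕ} {P : MvPolynomial (Fin 2) ℂ} (h : P.IsHomogeneous d)
    (c : ℂ) (Z : ℂ × ℂ) : ev P (c • Z) = c ^ d * ev P Z := by
  unfold ev
  have e : (![(c • Z).1, (c • Z).2] : Fin 2 → ℂ) = c • ![Z.1, Z.2] := by
    ext i; fin_cases i <;> simp
  rw [e, MvPolynomial.eval_eq', MvPolynomial.eval_eq', Finset.mul_sum]
  refine Finset.sum_congr rfl fun m hm => ?_
  have hdeg := h (MvPolynomial.mem_support_iff.mp hm)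
  have hs : m 0 + m 1 = d := by
    rw [← hdeg, Finsupp.weight_apply, Finsupp.sum_fintype] <;> simp [Fin.sum_univ_two]
  simp only [Fin.prod_univ_two, Pi.smul_apply, smul_eq_mul, mul_pow, ← hs, pow_add]
  ring

theorem aux_ev_cont (P : MvPolynomial (Fin 2) ℂ) : Continuous (ev P) := by
  unfold ev
  refine (MvPolynomial.continuous_eval P).comp ?_
  refine continuous_pi fun i => ?_
  fin_cases i
  · exact continuous_fst
  · exact continuous_snd

/-- The function `Z ↦ G^F(Z) − log ‖Z‖` is bounded on `ℂ² ∖ {(0,0)}`,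
and is invariant under scaling `Z ↦ cZ` for `c ∈ ℂ ∖ {0}` (so it descends to a bounded
continuous function, the dynamical Green function, on `ℙ¹(ℂ)`). -/
theorem stmt8 (d : ℕ) (hd : 2 ≤ d) (F₀ F₁ : MvPolynomial (Fin 2) ℂ)
    (h₀ : F₀.IsHomogeneous d) (h₁ : F₁.IsHomogeneous d)
    (hcz : ∀ Z : ℂ × ℂ, ev F₀ Z = 0 → ev F₁ Z = 0 → Z = 0)
    (G : ℂ × ℂ → ℝ)
    (hG : ∀ Z : ℂ × ℂ, Z ≠ 0 → Tendsto
      (fun n : ℕ => Real.log (enorm2 ((Fmap F₀ F₁)^[n] Z)) / (d : ℝ) ^ n)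
      atTop (nhds (G Z))) :
    (∃ C : ℝ, ∀ Z : ℂ × ℂ, Z ≠ 0 → |G Z - Real.log (enorm2 Z)| ≤ C) ∧
      ∀ c : ℂ, c ≠ 0 → ∀ Z : ℂ × ℂ, Z ≠ 0 →
        G (c • Z) - Real.log (enorm2 (c • Z)) = G Z - Real.log (enorm2 Z) := by
  have hd0 : (0 : ℝ) < d := by exact_mod_cast (by omega : 0 < d)
  have hdR : (2 : ℝ) ≤ d := by exact_mod_cast hd
  set F := Fmap F₀ F₁ with hF
  have hFne : ∀ Z, Z ≠ 0 → F Z ≠ 0 := by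
    intro Z hZ h
    exact hZ (hcz Z (congrArg Prod.fst h) (congrArg Prod.snd h))
  have hFs : ∀ (c : ℂ) Z, F (c • Z) = c ^ d • F Z := by
    intro c Z
    exact Prod.ext (aux_ev_smul h₀ c Z) (aux_ev_smul h₁ c Z)
  have hItne : ∀ n Z, Z ≠ 0 → F^[n] Z ≠ 0 := by
    intro n
    induction n with
    | zero => intro Z hZ; simpa using hZ
    | succ k ih => intro Z hZ; rw [Function.iterate_succ_apply]; exact ih _ (hFne Z hZ)
  have hIts : ∀ n (c : ℂ) Z, F^[n] (c • Z) = c ^ (d ^ n) • F^[n] Z := by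
    intro n
    induction n with
    | zero => intro c Z; simp
    | succ k ih =>
      intro c Z
      rw [Function.iterate_succ_apply, hFs, ih, Function.iterate_succ_apply, ← pow_mul, pow_succ']
  have hlog : ∀ (c : ℂ) Z, c ≠ 0 → Z ≠ 0 →
      Real.log (enorm2 (c • Z)) = Real.log ‖c‖ + Real.log (enorm2 Z) := by
    intro c Z hc hZ
    rw [aux_enorm2_smul, Real.log_mul (norm_ne_zero_iff.mpr hc) (aux_enorm2_pos hZ).ne']
  have hEc : Continuous enorm2 := by unfold enorm2; fun_prop
  have hFc : Continuous F := (aux_ev_cont F₀).prodMk (aux_ev_cont F₁)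
  have hB : ∃ B : ℝ, ∀ Z, Z ≠ 0 →
      |Real.log (enorm2 (F Z)) - d * Real.log (enorm2 Z)| ≤ B := by
    have hcomp : IsCompact (Metric.sphere (0 : ℂ × ℂ) 1) := isCompact_sphere _ _
    have hne : ∀ Z ∈ Metric.sphere (0 : ℂ × ℂ) 1, Z ≠ 0 := by
      rintro Z hZ rfl
      simp at hZ
    have hcont : ContinuousOn (fun Z => Real.log (enorm2 (F Z)) - d * Real.log (enorm2 Z))
        (Metric.sphere (0 : ℂ × ℂ) 1) := by
      refine ContinuousOn.sub ?_ (continuousOn_const.mul ?_)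
      · exact (hEc.comp hFc).continuousOn.log fun Z hZ => (aux_enorm2_pos (hFne Z (hne Z hZ))).ne'
      · exact hEc.continuousOn.log fun Z hZ => (aux_enorm2_pos (hne Z hZ)).ne'
    obtain ⟨B, hB⟩ := hcomp.exists_bound_of_continuousOn hcont
    refine ⟨B, fun Z hZ => ?_⟩
    have hn : ‖Z‖ ≠ 0 := norm_ne_zero_iff.mpr hZ
    have hc : ((‖Z‖⁻¹ : ℝ) : ℂ) ≠ 0 := by exact_mod_cast inv_ne_zero hn
    have := hB (((‖Z‖⁻¹ : ℝ) : ℂ) • Z) (by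
      rw [mem_sphere_zero_iff_norm, norm_smul, Complex.norm_real, norm_inv, norm_norm,
        inv_mul_cancel₀ hn])
    rw [Real.norm_eq_abs, hFs, hlog _ _ (pow_ne_zero _ hc) (hFne Z hZ), hlog _ _ hc hZ,
      norm_pow, Real.log_pow] at this
    convert this using 2
    ring
  constructor
  · obtain ⟨B, hB⟩ := hB
    have hB0 : 0 ≤ B := (abs_nonneg _).trans (hB (1, 0) (by simp))
    refine ⟨B, fun Z hZ => ?_⟩
    have key : ∀ n : ℕ, |Real.log (enorm2 (F^[n] Z)) / (d : ℝ) ^ n - Real.log (enorm2 Z)|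
        ≤ B * (1 - 1 / 2 ^ n) := by
      intro n
      induction n with
      | zero => simp
      | succ k ih =>
        have h1 := hB _ (hItne k Z hZ)
        rw [Function.iterate_succ_apply']
        set a := Real.log (enorm2 (F (F^[k] Z)))
        set b := Real.log (enorm2 (F^[k] Z))
        have e : a / (d : ℝ) ^ (k + 1) - Real.log (enorm2 Z)
            = (a - d * b) / (d : ℝ) ^ (k + 1) + (b / (d : ℝ) ^ k - Real.log (enorm2 Z)) := by
          field_simp
          ring
        have h2 : |(a - d * b) / (d : ℝ) ^ (k + 1)| ≤ B / 2 ^ (k + 1) := by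
          rw [abs_div, abs_of_pos (pow_pos hd0 (k + 1))]
          gcongr
        rw [e]
        refine (abs_add_le _ _).trans ((add_le_add h2 ih).trans (le_of_eq ?_))
        field_simp
        ring
    have ht : Tendsto (fun n : ℕ =>
        |Real.log (enorm2 (F^[n] Z)) / (d : ℝ) ^ n - Real.log (enorm2 Z)|) atTop
        (nhds |G Z - Real.log (enorm2 Z)|) := ((hG Z hZ).sub_const _).abs
    refine le_of_tendsto' ht fun n => (key n).trans ?_
    have : (0 : ℝ) ≤ 1 / 2 ^ n := by positivity
    nlinarith
  · intro c hc Z hZ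
    have h1 := hG (c • Z) (smul_ne_zero hc hZ)
    have h2 := (hG Z hZ).const_add (Real.log ‖c‖)
    have h3 : G (c • Z) = Real.log ‖c‖ + G Z := by
      refine tendsto_nhds_unique h1 (h2.congr fun n => ?_)
      rw [hIts, hlog _ _ (pow_ne_zero _ hc) (hItne n Z hZ), norm_pow, Real.log_pow]
      push_cast
      field_simp
    rw [h3, hlog c Z hc hZ]
    ring
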